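/- arXiv:math/0203249 — 2 statements merged into one kernel-verified Lean document; each statement's English description precedes it below -/
import Mathlib

section
/- (Subtraction) Let ρ : A → P be a basic scaling. (a) If x ∧ y = 0 and u, v ∈ A satisfy u ∨ v = 1, ρ(u) = ρ(x ∨ y), and ρ(v) = ρ(yᶜ), then ρ(u ∧ v) = ρ(x). (b) If w ∈ A satisfies x ∨ w = 1 and ρ(w) = ρ(yᶜ), and u, v ∈ A satisfy u ∧ v = 0, ρ(u) = ρ(x ∧ w), and ρ(v) = ρ(y), then ρ(u ∨ v) = ρ(x). (In sum-notation: the maps ζ ↦ ζ + η and ζ ↦ ζ ⊕ ∼η are mutually inverse.) -/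
/-- A *basic scaling* is a strictly increasing map from a Boolean algebra to a
partially ordered set that preserves relative complementation. -/
structure IsBasicScaling {A P : Type*} [BooleanAlgebra A] [PartialOrder P]
    (ρ : A → P) : Prop where
  mono : ∀ x y : A, x < y → ρ x < ρ y
  relcomp_lt : ∀ a b x y : A, a ≤ x → x ≤ b → a ≤ y → y ≤ b →
      ρ x < ρ y → ρ (a ⊔ (b ⊓ yᶜ)) < ρ (a ⊔ (b ⊓ xᶜ))
  relcomp_eq : ∀ a b x y : A, a ≤ x → x ≤ b → a ≤ y → y ≤ b →
      ρ x = ρ y → ρ (a ⊔ (b ⊓ xᶜ)) = ρ (a ⊔ (b ⊓ yᶜ))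

/-- A basic scaling is *divided* if whenever `ρ x < ρ y` there is `y₁ < y`
with `ρ y₁ = ρ x`. -/
def Divided {A P : Type*} [BooleanAlgebra A] [PartialOrder P] (ρ : A → P) : Prop :=
  ∀ x y : A, ρ x < ρ y → ∃ y₁, y₁ < y ∧ ρ y₁ = ρ x

theorem sdiff_eq_sdiff_sup_sup_inf {A : Type*} [BooleanAlgebra A] {y z : A} (x : A)
    (h : Disjoint y z) : x \ y = x \ (y ⊔ z) ⊔ x ⊓ z := by
  have hz : x \ y ⊓ z = x ⊓ z := by
    rw [sdiff_eq, inf_assoc, inf_eq_right.2 h.symm.le_compl_right]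
  rw [← sdiff_sdiff_left, ← hz, sup_comm, sup_inf_sdiff]

namespace IsBasicScaling

variable {A P : Type*} [BooleanAlgebra A] [PartialOrder P] {ρ : A → P}

theorem compl_congr (h : IsBasicScaling ρ) {x y : A} (hxy : ρ x = ρ y) : ρ xᶜ = ρ yᶜ := by
  simpa using h.relcomp_eq ⊥ ⊤ x y bot_le le_top bot_le le_top hxy

theorem sup_right_congr (h : IsBasicScaling ρ) {x y z : A} (hx : Disjoint x z)
    (hy : Disjoint y z) (hxy : ρ x = ρ y) : ρ (x ⊔ z) = ρ (y ⊔ z) := by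
  have key := h.compl_congr (h.relcomp_eq ⊥ zᶜ x y bot_le hx.le_compl_right bot_le
    hy.le_compl_right hxy)
  simpa [sup_comm] using key

theorem sup_right_cancel (h : IsBasicScaling ρ) {x y z : A} (hx : Disjoint x z)
    (hy : Disjoint y z) (hxy : ρ (x ⊔ z) = ρ (y ⊔ z)) : ρ x = ρ y := by
  have key := h.relcomp_eq z ⊤ (x ⊔ z) (y ⊔ z) le_sup_right le_top le_sup_right le_top hxy
  have key := h.compl_congr key
  have aux {t : A} (ht : Disjoint t z) : (z ⊔ ⊤ ⊓ (t ⊔ z)ᶜ)ᶜ = t := by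
    simp [inf_sup_right, inf_comm zᶜ, ht.le_compl_right]
  rwa [aux hx, aux hy] at key

theorem sdiff_congr (h : IsBasicScaling ρ) {x y : A} (hxy : ρ x = ρ y) :
    ρ (x \ y) = ρ (y \ x) := by
  refine h.sup_right_cancel (z := x ⊓ y) (disjoint_inf_sdiff.symm)
    (inf_comm x y ▸ disjoint_inf_sdiff.symm) ?_
  rw [sup_comm, sup_inf_sdiff, sup_comm, inf_comm, sup_inf_sdiff, hxy]

theorem congr_of_sdiff (h : IsBasicScaling ρ) {x y : A} (hxy : ρ (x \ y) = ρ (y \ x)) :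
    ρ x = ρ y := by
  have key := h.sup_right_congr (z := x ⊓ y) (disjoint_inf_sdiff.symm)
    (inf_comm x y ▸ disjoint_inf_sdiff.symm) hxy
  rwa [sup_comm, sup_inf_sdiff, sup_comm, inf_comm, sup_inf_sdiff] at key

/-- The sum of the scales of two disjoint elements is well defined. -/
theorem sup_congr (h : IsBasicScaling ρ) {x y x' y' : A} (hd : Disjoint x y)
    (hd' : Disjoint x' y') (hx : ρ x = ρ x') (hy : ρ y = ρ y') : ρ (x ⊔ y) = ρ (x' ⊔ y') := by
  have hX := h.sup_right_congr (z := y \ (x' ⊔ y'))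
    (hd.mono sdiff_le sdiff_le) (disjoint_sdiff_self_right.mono_left
      (sdiff_le.trans le_sup_left)) (h.sdiff_congr hx)
  have hY := h.sup_right_congr (z := x' \ (x ⊔ y))
    (disjoint_sdiff_self_right.mono_left (sdiff_le.trans le_sup_right))
    (hd'.symm.mono sdiff_le sdiff_le) (h.sdiff_congr hy)
  have hmid : x' \ x ⊔ y \ (x' ⊔ y') = y \ y' ⊔ x' \ (x ⊔ y) := by
    rw [sdiff_eq_sdiff_sup_sup_inf x' hd, sdiff_eq_sdiff_sup_sup_inf y hd'.symm,
      sup_comm y' x', inf_comm y x']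
    ac_rfl
  have hl : x \ x' ⊔ y \ (x' ⊔ y') = (x ⊔ y) \ (x' ⊔ y') ⊔ x ⊓ y' := by
    rw [sdiff_eq_sdiff_sup_sup_inf x hd', sup_sdiff]
    ac_rfl
  have hr : y' \ y ⊔ x' \ (x ⊔ y) = (x' ⊔ y') \ (x ⊔ y) ⊔ x ⊓ y' := by
    rw [sdiff_eq_sdiff_sup_sup_inf y' hd.symm, sup_sdiff, sup_comm y x, inf_comm y' x]
    ac_rfl
  refine h.congr_of_sdiff (h.sup_right_cancel (z := x ⊓ y')
    (disjoint_sdiff_self_left.mono_right (inf_le_right.trans le_sup_right))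
    (disjoint_sdiff_self_left.mono_right (inf_le_left.trans le_sup_left)) ?_)
  rw [← hl, ← hr, hX, hmid, hY]

/-- The dual sum of the scales of two codisjoint elements is well defined. -/
theorem inf_congr (h : IsBasicScaling ρ) {x y x' y' : A} (hc : x ⊔ y = ⊤)
    (hc' : x' ⊔ y' = ⊤) (hx : ρ x = ρ x') (hy : ρ y = ρ y') : ρ (x ⊓ y) = ρ (x' ⊓ y') := by
  have hd {a b : A} (hab : a ⊔ b = ⊤) : Disjoint aᶜ bᶜ := by
    rw [disjoint_iff, ← compl_sup, hab, compl_top]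
  simpa using h.compl_congr (h.sup_congr (hd hc) (hd hc') (h.compl_congr hx) (h.compl_congr hy))

end IsBasicScaling

theorem stmt_6 {A P : Type*} [BooleanAlgebra A] [PartialOrder P] (ρ : A → P)
    (h : IsBasicScaling ρ) (x y : A) :
    (x ⊓ y = ⊥ → ∀ u v : A, u ⊔ v = ⊤ → ρ u = ρ (x ⊔ y) → ρ v = ρ yᶜ →
      ρ (u ⊓ v) = ρ x) ∧
    (∀ w : A, x ⊔ w = ⊤ → ρ w = ρ yᶜ → ∀ u v : A, u ⊓ v = ⊥ →
      ρ u = ρ (x ⊓ w) → ρ v = ρ y → ρ (u ⊔ v) = ρ x) := by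
  refine ⟨fun hxy u v huv hu hv => ?_, fun w hxw hw u v huv hu hv => ?_⟩
  · have hx : x ⊓ yᶜ = x := inf_eq_left.2 (disjoint_iff.2 hxy).le_compl_right
    rw [h.inf_congr huv (by rw [sup_assoc, sup_compl_eq_top, sup_top_eq]) hu hv, inf_sup_right,
      inf_compl_self, sup_bot_eq, hx]
  · have hwy : ρ wᶜ = ρ y := by simpa using h.compl_congr hw
    have hx : x ⊔ wᶜ = x :=
      sup_eq_left.2 (codisjoint_iff_compl_le_left.1 (codisjoint_iff.2 hxw))
    rw [h.sup_congr (disjoint_iff.2 huv) (disjoint_compl_right.mono_left inf_le_right) hu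
      (hv.trans hwy.symm), sup_inf_right, sup_compl_eq_top, inf_top_eq, hx]
end

section
/- (Continuity at 2-valued homomorphisms implies no infinitesimals) Let ρ : A → L be a basic scaling whose codomain L is linearly ordered, and suppose ρ is continuous at every 2-valued homomorphism on A; that is, for every Boolean algebra homomorphism φ from A to the two-element Boolean algebra {0,1} and every b ∈ A, if b is the greatest lower bound in A of the set {x ∈ A : φ(x) = 1}, then ρ(b) is the greatest lower bound in L of {ρ(x) : x ∈ A, φ(x) = 1}. Then there is no δ in the image of ρ with ρ(0) < δ that is an infinitesimal, i.e., no such δ admits an infinite pairwise disjoint subset X of A with δ ≤ ρ(x) for every x ∈ X. -/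
namespace IsBasicScaling

variable {A L : Type*} [BooleanAlgebra A]

theorem monotone [PartialOrder L] {ρ : A → L} (h : IsBasicScaling ρ) : Monotone ρ :=
  StrictMono.monotone fun x y hxy => h.mono x y hxy

variable [LinearOrder L] {ρ : A → L}

/-- Joining with an element disjoint from both sides preserves comparison. -/
theorem sup_le_sup_of_disjoint (h : IsBasicScaling ρ) {x y z : A} (hxz : Disjoint x z)
    (hyz : Disjoint y z) (hxy : ρ x ≤ ρ y) : ρ (x ⊔ z) ≤ ρ (y ⊔ z) := by
  have complement_left : ∀ u v : A, ⊥ ⊔ ((u ⊔ v) ⊓ uᶜ) = v \ u := fun u v => by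
    rw [bot_sup_eq, ← sdiff_eq, sup_sdiff_left_self]
  have complement_sdiff : ∀ u v : A, Disjoint u z →
      ⊥ ⊔ ((u ⊔ v ⊔ z) ⊓ (u \ v)ᶜ) = v ⊔ z := fun u v huz => by
    rw [bot_sup_eq, ← sdiff_eq, sup_sdiff, sup_sdiff, sdiff_sdiff_right_self,
      (show Disjoint v (u \ v) from disjoint_sdiff_self_right).sdiff_eq_left,
      (huz.symm.mono_right sdiff_le).sdiff_eq_left, sup_eq_right.2 (inf_le_right : u ⊓ v ≤ v)]
  have hx : x \ y ≤ x ⊔ y ⊔ z := sdiff_le.trans (le_sup_left.trans le_sup_left)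
  have hy : y \ x ≤ x ⊔ y ⊔ z := sdiff_le.trans (le_sup_right.trans le_sup_left)
  have cx := complement_left x y
  have cy := complement_left y x
  have dx := complement_sdiff x y hxz
  have dy := complement_sdiff y x hyz
  rw [sup_comm y x] at cy dy
  rcases hxy.lt_or_eq with hlt | heq
  · have key := h.relcomp_lt ⊥ (x ⊔ y) x y bot_le le_sup_left bot_le le_sup_right hlt
    rw [cx, cy] at key
    have key' := h.relcomp_lt ⊥ (x ⊔ y ⊔ z) _ _ bot_le hx bot_le hy key
    rw [dx, dy] at key'
    exact key'.le
  · have key := h.relcomp_eq ⊥ (x ⊔ y) x y bot_le le_sup_left bot_le le_sup_right heq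
    rw [cx, cy] at key
    have key' := h.relcomp_eq ⊥ (x ⊔ y ⊔ z) _ _ bot_le hy bot_le hx key
    rw [dx, dy] at key'
    exact key'.le

theorem sup_le_sup (h : IsBasicScaling ρ) {a₁ a₂ b₁ b₂ : A} (hb : Disjoint b₁ b₂)
    (h₁ : ρ a₁ ≤ ρ b₁) (h₂ : ρ a₂ ≤ ρ b₂) : ρ (a₁ ⊔ a₂) ≤ ρ (b₁ ⊔ b₂) := by
  wlog ha : Disjoint a₁ a₂ generalizing a₂
  · rw [← sup_sdiff_self_right]
    exact this ((h.monotone sdiff_le).trans h₂) disjoint_sdiff_self_right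
  have first : ρ (a₁ ⊔ a₂ \ b₁) ≤ ρ (b₁ ⊔ a₂ \ b₁) :=
    h.sup_le_sup_of_disjoint (ha.mono_right sdiff_le) disjoint_sdiff_self_right h₁
  have second : ρ (a₂ ⊔ b₁ \ a₂) ≤ ρ (b₂ ⊔ b₁ \ a₂) :=
    h.sup_le_sup_of_disjoint disjoint_sdiff_self_right (hb.symm.mono_right sdiff_le) h₂
  rw [sup_sdiff_self_right] at first second
  rw [sup_comm a₂ b₁] at second
  have third := h.sup_le_sup_of_disjoint (z := a₂ ⊓ b₁)
    (Disjoint.sup_left (ha.mono_right inf_le_left)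
      (disjoint_sdiff_self_left.mono_right inf_le_right))
    (Disjoint.sup_left (hb.symm.mono_right inf_le_right)
      (disjoint_sdiff_self_left.mono_right inf_le_left))
    (first.trans second)
  rwa [sup_assoc, sup_comm (a₂ \ b₁), sup_inf_sdiff, sup_assoc, inf_comm,
    sup_comm (b₁ \ a₂), sup_inf_sdiff, sup_comm b₂] at third

theorem sup_le_sup_of_pairwiseDisjoint (h : IsBasicScaling ρ) {x : ℕ → A}
    (hx : Pairwise (Function.onFun Disjoint x)) {y : A} (hy : ∀ n, ρ y ≤ ρ (x n))
    (s : Finset A) (hs : ∀ u ∈ s, ρ u < ρ y) :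
    ρ (s.sup id) ≤ ρ ((Finset.range s.card).sup x) := by
  classical
  induction s using Finset.induction_on with
  | empty => simp
  | insert a s has ih =>
    rw [Finset.card_insert_of_notMem has, Finset.range_add_one, Finset.sup_insert,
      Finset.sup_insert]
    refine h.sup_le_sup ?_ ((hs a (by simp)).le.trans (hy _))
      (ih fun u hu => hs u (Finset.mem_insert_of_mem hu))
    rw [Finset.disjoint_sup_right]
    intro i hi
    exact hx (by have := Finset.mem_range.1 hi; omega)

/-- An infinite disjoint family of large elements cannot lie below a finite join of small ones. -/
theorem not_forall_le_sup (h : IsBasicScaling ρ) {y : A} (hy₀ : ρ ⊥ < ρ y) {X : Set A}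
    (hX : X.Infinite) (hd : X.Pairwise Disjoint) (hy : ∀ x ∈ X, ρ y ≤ ρ x)
    (s : Finset A) (hs : ∀ u ∈ s, ρ u < ρ y) : ¬ ∀ x ∈ X, x ≤ s.sup id := by
  intro hle
  let x : ℕ → A := fun n => hX.natEmbedding X n
  have hmem : ∀ n, x n ∈ X := fun n => (hX.natEmbedding X n).2
  have hx : Pairwise (Function.onFun Disjoint x) := fun i j hij =>
    hd (hmem i) (hmem j) fun e => hij ((hX.natEmbedding X).injective (Subtype.ext e))
  have hbound := h.sup_le_sup_of_pairwiseDisjoint hx (fun n => hy _ (hmem n)) s hs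
  have hdisj : Disjoint ((Finset.range s.card).sup x) (x s.card) := by
    rw [Finset.disjoint_sup_left]
    intro i hi
    exact hx (Finset.mem_range.1 hi).ne
  have hne : x s.card ≠ ⊥ := fun e => by
    have := hy _ (hmem s.card)
    rw [e] at this
    exact absurd hy₀ this.not_gt
  have hlt : (Finset.range s.card).sup x < s.sup id := by
    refine lt_of_le_of_ne (Finset.sup_le fun i _ => hle _ (hmem i)) fun e => hne ?_
    exact disjoint_self.1 (hdisj.mono_left (e ▸ hle _ (hmem s.card)))
  exact absurd (h.mono _ _ hlt) hbound.not_gt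

end IsBasicScaling

/-- All but finitely many members of a disjoint family miss a given finite set of atoms. -/
theorem Set.Infinite.disjoint_sup_atoms {A : Type*} [BooleanAlgebra A] {X : Set A}
    (hX : X.Infinite) (hd : X.Pairwise Disjoint) (t : Finset A) (ht : ∀ a ∈ t, IsAtom a) :
    {x ∈ X | Disjoint x (t.sup id)}.Infinite := by
  have hfin : (⋃ a ∈ t, {x ∈ X | ¬ Disjoint x a}).Finite := by
    refine t.finite_toSet.biUnion fun a ha => Set.Subsingleton.finite ?_
    rintro x ⟨hx, hxa⟩ y ⟨hy, hya⟩
    by_contra hxy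
    have hax : a ≤ x := (ht a ha).not_disjoint_iff_le.1 fun e => hxa e.symm
    have hay : a ≤ y := (ht a ha).not_disjoint_iff_le.1 fun e => hya e.symm
    exact (ht a ha).1 (disjoint_self.1 ((hd hx hy hxy).mono hax hay))
  refine (hX.sdiff hfin).mono ?_
  rintro x ⟨hx, hxt⟩
  refine ⟨hx, (Finset.disjoint_sup_right).2 fun a ha => ?_⟩
  by_contra hxa
  exact hxt (Set.mem_biUnion (Finset.mem_coe.2 ha) ⟨hx, hxa⟩)

/-- The ideal generated by a set. -/
def Order.Ideal.generate {A : Type*} [BooleanAlgebra A] (G : Set A) : Order.Ideal A where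
  carrier := {c | ∃ s : Finset A, ↑s ⊆ G ∧ c ≤ s.sup id}
  lower' := fun _ _ hab ⟨s, hs, hle⟩ => ⟨s, hs, hab.trans hle⟩
  nonempty' := ⟨⊥, ∅, by simp, bot_le⟩
  directed' := by
    classical
    rintro a ⟨s, hs, ha⟩ b ⟨t, ht, hb⟩
    refine ⟨a ⊔ b, ⟨s ∪ t, by simp [hs, ht], ?_⟩, le_sup_left, le_sup_right⟩
    rw [Finset.sup_union]
    exact _root_.sup_le_sup ha hb

/-- A set with no finite subset joining to `⊤` is killed by some two-valued homomorphism. -/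
theorem exists_boundedLatticeHom_eq_false {A : Type*} [BooleanAlgebra A] (G : Set A)
    (hG : ∀ s : Finset A, ↑s ⊆ G → s.sup id ≠ ⊤) :
    ∃ φ : BoundedLatticeHom A Bool, ∀ g ∈ G, φ g = false := by
  classical
  obtain ⟨J, hJ, hIJ, hdisj⟩ := DistribLattice.prime_ideal_of_disjoint_filter_ideal
    (F := Order.PFilter.principal (⊤ : A)) (I := Order.Ideal.generate G) (by
      rw [Set.disjoint_left]
      rintro c hc ⟨s, hs, hle⟩
      exact hG s hs (top_le_iff.1 (le_trans (Order.PFilter.mem_principal.1 hc) hle)))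
  have htop : ⊤ ∉ J := fun ht =>
    Set.disjoint_left.1 hdisj (Order.PFilter.mem_principal.2 le_rfl) ht
  refine ⟨{ toFun := fun x => decide (x ∉ J), map_sup' := ?_, map_inf' := ?_,
            map_top' := ?_, map_bot' := ?_ }, ?_⟩
  · intro a b
    by_cases ha : a ∈ J <;> by_cases hb : b ∈ J <;> simp [ha, hb]
  · intro a b
    have hinf : a ⊓ b ∈ J ↔ a ∈ J ∨ b ∈ J :=
      ⟨hJ.mem_or_mem, fun hab => hab.elim (J.lower inf_le_left) (J.lower inf_le_right)⟩
    by_cases ha : a ∈ J <;> by_cases hb : b ∈ J <;> simp [hinf, ha, hb]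
  · simp [htop]
  · simp
  · intro g hg
    have : g ∈ J := hIJ ⟨{g}, by simpa using hg, by simp⟩
    exact decide_eq_false (not_not.2 this)

/-- A two-valued homomorphism vanishing on atoms has greatest lower bound `⊥`. -/
theorem isGLB_bot_of_map_atoms {A : Type*} [BooleanAlgebra A] (φ : BoundedLatticeHom A Bool)
    (hφ : ∀ a, IsAtom a → φ a = false) : IsGLB {x : A | φ x = true} ⊥ := by
  refine ⟨fun _ _ => bot_le, fun b hb => ?_⟩
  have hcompl : ∀ c ≤ b, φ c = false → c = ⊥ := fun c hcb hc => by
    have : b ≤ cᶜ := hb (by simp [hc])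
    exact disjoint_self.1 (le_compl_iff_disjoint_left.1 (hcb.trans this))
  by_contra hbot
  have hatom : IsAtom b := by
    refine ⟨fun e => hbot e.le, fun c hc => hcompl c hc.le ?_⟩
    by_contra hne
    exact hc.not_ge (hb (by simpa using hne))
  exact hbot (hcompl b le_rfl (hφ b hatom)).le

theorem stmt_17 {A L : Type*} [BooleanAlgebra A] [LinearOrder L] (ρ : A → L)
    (h : IsBasicScaling ρ)
    (hcont : ∀ (φ : BoundedLatticeHom A Bool) (b : A),
      IsGLB {x : A | φ x = true} b → IsGLB (ρ '' {x : A | φ x = true}) (ρ b)) :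
    ¬ ∃ (y : A) (X : Set A), ρ ⊥ < ρ y ∧ X.Infinite ∧
      X.Pairwise (fun x x' => x ⊓ x' = ⊥) ∧ ∀ x ∈ X, ρ y ≤ ρ x := by
  classical
  rintro ⟨y, X, hy₀, hX, hXd, hXy⟩
  have hd : X.Pairwise Disjoint := hXd.imp fun _ _ e => disjoint_iff.2 e
  obtain ⟨φ, hφ⟩ := exists_boundedLatticeHom_eq_false {u : A | ρ u < ρ y ∨ IsAtom u} <| by
    intro s hs hsup
    refine h.not_forall_le_sup hy₀
      (hX.disjoint_sup_atoms hd (s.filter IsAtom) fun a ha => (Finset.mem_filter.1 ha).2)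
      (hd.mono fun _ hx => hx.1) (fun x hx => hXy x hx.1) (s.filter fun u => ¬ IsAtom u)
      (fun u hu => ?_) fun x hx => ?_
    · obtain ⟨hus, hua⟩ := Finset.mem_filter.1 hu
      exact (hs hus).resolve_right hua
    · refine Disjoint.left_le_of_le_sup_left (c := (s.filter IsAtom).sup id) ?_ hx.2
      rw [← Finset.sup_union, Finset.filter_union_filter_not_eq, hsup]
      exact le_top
  have hglb := hcont φ ⊥ (isGLB_bot_of_map_atoms φ fun a ha => hφ a (Or.inr ha))
  refine hy₀.not_ge (hglb.2 ?_)
  rintro _ ⟨x, hx, rfl⟩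
  by_contra hlt
  have := hφ x (Or.inl (not_le.1 hlt))
  simp_all
end
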